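/- Fix K > 0 and let K_P be the set of f ∈ L²((0,∞)) such that: f is absolutely continuous on every compact interval of ℝ, ‖f‖_{L²}=1, ∫₀^∞ i f'(ω)·conj(f(ω)) dω = 0, ∫₀^∞ ln(ω)|f(ω)|² dω = 0, the functions f', √ω·f', f/ω and ln(ω)·f lie in L²((0,∞)), and the four bounds hold: ∫₀^∞ |f'(ω)|² dω ≤ K; ∫₀^∞ (ln ω)²|f(ω)|² dω ≤ K; (1/W)·(∫₀^∞ ω|f'(ω)|² dω)·(∫₀^∞ |f(ω)|²/ω² dω) ≤ K; and (1/W)·∫₀^∞ (ln ω)²|f(ω)|²/ω dω − (1/W²)·(∫₀^∞ ln(ω)|f(ω)|²/ω dω)² ≤ K, where W = ∫₀^∞ |f(ω)|²/ω dω. Then K_P is closed in L²((0,∞)). -/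

import Mathlib

open MeasureTheory Set Filter Topology
open scoped ENNReal Topology

noncomputable section

/-- The set `K_P ⊂ L²((0,∞)) ⊂ L²(ℝ)`: elements having a representative `f`
supported in `(0,∞)`, absolutely continuous on every compact interval with
derivative `g` (encoded by `f x = ∫₀ˣ g`), normalized `‖f‖ = 1`, with zero
expected time and zero expected scale, such that `f'`, `√ω·f'`, `f/ω` and
`ln(ω)·f` all lie in `L²((0,∞))`, and the four terms of the pulled-back phase
space uncertainty are each bounded by `K`, where `W = ∫₀^∞ |f(ω)|²/ω dω` is the
squared window-space norm. -/
def KP (K : ℝ) : Set (Lp ℂ 2 (volume : Measure ℝ)) :=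
  {F | ∃ f g : ℝ → ℂ, (⇑F =ᵐ[volume] f) ∧
    (∀ x : ℝ, x ≤ 0 → f x = 0) ∧
    (∀ x : ℝ, IntervalIntegrable g volume 0 x) ∧
    (∀ x : ℝ, f x = ∫ t in (0:ℝ)..x, g t) ∧
    (∫ ω in Set.Ioi (0:ℝ), ‖f ω‖ ^ 2 = 1) ∧
    (∫ ω in Set.Ioi (0:ℝ), Complex.I * g ω * (starRingEnd ℂ) (f ω) = 0) ∧
    (∫ ω in Set.Ioi (0:ℝ), Real.log ω * ‖f ω‖ ^ 2 = 0) ∧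
    MemLp g 2 (volume.restrict (Set.Ioi (0:ℝ))) ∧
    MemLp (fun ω : ℝ => (Real.sqrt ω : ℂ) * g ω) 2 (volume.restrict (Set.Ioi (0:ℝ))) ∧
    MemLp (fun ω : ℝ => f ω / (ω : ℂ)) 2 (volume.restrict (Set.Ioi (0:ℝ))) ∧
    MemLp (fun ω : ℝ => (Real.log ω : ℂ) * f ω) 2 (volume.restrict (Set.Ioi (0:ℝ))) ∧
    (∫ ω in Set.Ioi (0:ℝ), ‖g ω‖ ^ 2 ≤ K) ∧
    (∫ ω in Set.Ioi (0:ℝ), (Real.log ω) ^ 2 * ‖f ω‖ ^ 2 ≤ K) ∧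
    ((1 / ∫ ω in Set.Ioi (0:ℝ), ‖f ω‖ ^ 2 / ω) *
        ((∫ ω in Set.Ioi (0:ℝ), ω * ‖g ω‖ ^ 2) *
          (∫ ω in Set.Ioi (0:ℝ), ‖f ω‖ ^ 2 / ω ^ 2)) ≤ K) ∧
    ((1 / ∫ ω in Set.Ioi (0:ℝ), ‖f ω‖ ^ 2 / ω) *
        (∫ ω in Set.Ioi (0:ℝ), (Real.log ω) ^ 2 * ‖f ω‖ ^ 2 / ω) -
      (1 / (∫ ω in Set.Ioi (0:ℝ), ‖f ω‖ ^ 2 / ω) ^ 2) *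
        (∫ ω in Set.Ioi (0:ℝ), Real.log ω * ‖f ω‖ ^ 2 / ω) ^ 2 ≤ K)}


local notation "μ₀" => (volume.restrict (Set.Ioi (0:ℝ)) : Measure ℝ)

lemma squeeze_aux (x y : ℕ → ℝ) (hy : Tendsto y atTop (𝓝 0))
    (h : ∀ δ > 0, ∃ C : ℝ, ∀ n, |x n| ≤ δ + C * y n) : Tendsto x atTop (𝓝 0) := by
  rw [Metric.tendsto_atTop']
  intro ε hε
  obtain ⟨C, hC⟩ := h (ε/2) (by positivity)
  have h1 : Tendsto (fun n => C * y n) atTop (𝓝 (C * 0)) := hy.const_mul C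
  rw [mul_zero] at h1
  have h2 := (h1.eventually (gt_mem_nhds (show (0:ℝ) < ε/2 by positivity)))
  obtain ⟨N, hN⟩ := eventually_atTop.1 h2
  refine ⟨N, fun n hn => ?_⟩
  rw [Real.dist_eq, sub_zero]
  linarith [hC n, hN n hn.le]

lemma fatou_aux {μ : Measure ℝ} (h : ℕ → ℝ → ℝ) (h' : ℝ → ℝ) (c : ℕ → ℝ) (c' : ℝ)
    (hi : ∀ n, Integrable (h n) μ) (hpos : ∀ n, 0 ≤ᵐ[μ] h n)
    (hlim : ∀ᵐ x ∂μ, Tendsto (fun n => h n x) atTop (𝓝 (h' x)))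
    (hc : ∀ n, ∫ x, h n x ∂μ ≤ c n) (hcl : Tendsto c atTop (𝓝 c')) :
    Integrable h' μ ∧ ∫ x, h' x ∂μ ≤ c' := by
  have hm : AEStronglyMeasurable h' μ :=
    aestronglyMeasurable_of_tendsto_ae atTop (fun n => (hi n).aestronglyMeasurable) hlim
  have hpos' : 0 ≤ᵐ[μ] h' := by
    filter_upwards [hlim, ae_all_iff.2 hpos] with x hx hp
    exact ge_of_tendsto' hx hp
  have hc0 : 0 ≤ c' := ge_of_tendsto' hcl fun n =>
    (integral_nonneg_of_ae (hpos n)).trans (hc n)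
  have key : ∫⁻ x, ENNReal.ofReal (h' x) ∂μ ≤ ENNReal.ofReal c' := by
    calc ∫⁻ x, ENNReal.ofReal (h' x) ∂μ
        = ∫⁻ x, liminf (fun n => ENNReal.ofReal (h n x)) atTop ∂μ := by
          apply lintegral_congr_ae
          filter_upwards [hlim] with x hx
          exact ((ENNReal.continuous_ofReal.tendsto _).comp hx).liminf_eq.symm
      _ ≤ liminf (fun n => ∫⁻ x, ENNReal.ofReal (h n x) ∂μ) atTop :=
          lintegral_liminf_le' fun n => (hi n).aestronglyMeasurable.aemeasurable.ennreal_ofReal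
      _ ≤ liminf (fun n => ENNReal.ofReal (c n)) atTop := by
          refine liminf_le_liminf (Eventually.of_forall fun n => ?_)
          rw [← ofReal_integral_eq_lintegral_ofReal (hi n) (hpos n)]
          exact ENNReal.ofReal_le_ofReal (hc n)
      _ = ENNReal.ofReal c' := ((ENNReal.continuous_ofReal.tendsto _).comp hcl).liminf_eq
  have hint : Integrable h' μ := by
    refine ⟨hm, ?_⟩
    rw [hasFiniteIntegral_iff_ofReal hpos']
    exact key.trans_lt ENNReal.ofReal_lt_top
  refine ⟨hint, ?_⟩
  rw [← ofReal_integral_eq_lintegral_ofReal hint hpos'] at key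
  exact (ENNReal.ofReal_le_ofReal_iff hc0).1 key

lemma weight_aux (h : ℕ → ℝ → ℝ) (h' φ ψ : ℝ → ℝ) (B : ℝ) (hφ : Measurable φ)
    (hi : ∀ n, Integrable (h n) μ₀) (hi' : Integrable h' μ₀)
    (hψ : ∀ x, 0 ≤ ψ x) (hp : ∀ n x, 0 ≤ h n x) (hp' : ∀ x, 0 ≤ h' x)
    (hψi : ∀ n, Integrable (fun x => ψ x * h n x) μ₀)
    (hψi' : Integrable (fun x => ψ x * h' x) μ₀)
    (hB : ∀ n, ∫ x, ψ x * h n x ∂μ₀ ≤ B) (hB' : ∫ x, ψ x * h' x ∂μ₀ ≤ B)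
    (hl : Tendsto (fun n => ∫ x, |h n x - h' x| ∂μ₀) atTop (𝓝 0))
    (hw : ∀ ε > 0, ∃ C, ∀ ω > 0, |φ ω| ≤ ε * ψ ω + C) :
    Tendsto (fun n => ∫ x, φ x * h n x ∂μ₀) atTop (𝓝 (∫ x, φ x * h' x ∂μ₀)) := by
  have hint : ∀ k : ℝ → ℝ, Integrable k μ₀ → (∀ x, 0 ≤ k x) →
      Integrable (fun x => ψ x * k x) μ₀ → Integrable (fun x => φ x * k x) μ₀ := by
    intro k hk hk0 hψk
    obtain ⟨C, hC⟩ := hw 1 one_pos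
    refine Integrable.mono' (hψk.add (hk.const_mul C))
      (hφ.aestronglyMeasurable.mul hk.aestronglyMeasurable) ?_
    filter_upwards [ae_restrict_mem measurableSet_Ioi] with x hx
    have := mul_le_mul_of_nonneg_right (hC x hx) (hk0 x)
    simp only [Pi.add_apply, norm_mul, Real.norm_eq_abs, abs_of_nonneg (hk0 x)]
    linarith
  have h1 : ∀ n, Integrable (fun x => φ x * h n x) μ₀ := fun n => hint _ (hi n) (hp n) (hψi n)
  have h2 := hint _ hi' hp' hψi'
  rw [← tendsto_sub_nhds_zero_iff]
  refine squeeze_aux _ _ hl fun δ hδ => ?_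
  have hε : 0 < δ / (2 * |B| + 1) := by positivity
  obtain ⟨C, hC⟩ := hw _ hε
  set ε := δ / (2 * |B| + 1) with hεd
  refine ⟨C, fun n => ?_⟩
  rw [← integral_sub (h1 n) h2]
  have hd : Integrable (fun x => |h n x - h' x|) μ₀ := ((hi n).sub hi').abs
  calc |∫ x, (φ x * h n x - φ x * h' x) ∂μ₀|
      ≤ ∫ x, |φ x * h n x - φ x * h' x| ∂μ₀ := abs_integral_le_integral_abs
    _ ≤ ∫ x, (ε * (ψ x * h n x + ψ x * h' x) + C * |h n x - h' x|) ∂μ₀ := by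
        refine integral_mono_ae ((h1 n).sub h2).abs
          ((((hψi n).add hψi').const_mul ε).add (hd.const_mul C)) ?_
        filter_upwards [ae_restrict_mem measurableSet_Ioi] with x hx
        have e1 := mul_le_mul_of_nonneg_right (hC x hx) (abs_nonneg (h n x - h' x))
        have e2 : |h n x - h' x| ≤ h n x + h' x := by
          rw [abs_le]; constructor <;> linarith [hp n x, hp' x]
        rw [← mul_sub, abs_mul]
        have := mul_le_mul_of_nonneg_left e2 (mul_nonneg hε.le (hψ x))
        linarith
    _ = ε * (∫ x, ψ x * h n x ∂μ₀ + ∫ x, ψ x * h' x ∂μ₀) + C * ∫ x, |h n x - h' x| ∂μ₀ := by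
        have hs : Integrable (fun x => ψ x * h n x + ψ x * h' x) μ₀ := (hψi n).add hψi'
        rw [integral_add (hs.const_mul ε) (hd.const_mul C),
          integral_const_mul, integral_const_mul, integral_add (hψi n) hψi']
    _ ≤ δ + C * ∫ x, |h n x - h' x| ∂μ₀ := by
        have : ε * (∫ x, ψ x * h n x ∂μ₀ + ∫ x, ψ x * h' x ∂μ₀) ≤ ε * (2 * |B| + 1) := by
          apply mul_le_mul_of_nonneg_left _ hε.le
          linarith [hB n, le_abs_self B]
        have e : ε * (2 * |B| + 1) = δ := by rw [hεd]; field_simp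
        linarith

lemma sq_diff_aux {μ : Measure ℝ} (f : ℕ → ℝ → ℂ) (f' : ℝ → ℂ) (hf : ∀ n, MemLp (f n) 2 μ) (hf' : MemLp f' 2 μ)
    (hl : Tendsto (fun n => ∫ x, ‖f n x - f' x‖ ^ 2 ∂μ) atTop (𝓝 0)) :
    Tendsto (fun n => ∫ x, |‖f n x‖ ^ 2 - ‖f' x‖ ^ 2| ∂μ) atTop (𝓝 0) := by
  refine squeeze_aux _ _ hl fun δ hδ => ?_
  have hi' : Integrable (fun x => ‖f' x‖ ^ 2) μ := hf'.integrable_norm_pow two_ne_zero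
  set M := ∫ x, ‖f' x‖ ^ 2 ∂μ with hM
  have hM0 : 0 ≤ M := integral_nonneg fun x => by positivity
  set ε := δ / (M + 1) with hε
  have hε0 : 0 < ε := by positivity
  refine ⟨1 + 1 / ε, fun n => ?_⟩
  have hi : Integrable (fun x => ‖f n x‖ ^ 2) μ := (hf n).integrable_norm_pow two_ne_zero
  have hd : Integrable (fun x => ‖f n x - f' x‖ ^ 2) μ :=
    ((hf n).sub hf').integrable_norm_pow two_ne_zero
  rw [abs_of_nonneg (integral_nonneg fun x => abs_nonneg _)]
  calc ∫ x, |‖f n x‖ ^ 2 - ‖f' x‖ ^ 2| ∂μ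
      ≤ ∫ x, (ε * ‖f' x‖ ^ 2 + (1 + 1/ε) * ‖f n x - f' x‖ ^ 2) ∂μ := by
        refine integral_mono (hi.sub hi').abs ((hi'.const_mul _).add (hd.const_mul _)) fun x => ?_
        dsimp only
        have e1 : |‖f n x‖ - ‖f' x‖| ≤ ‖f n x - f' x‖ := abs_norm_sub_norm_le _ _
        set a := ‖f n x‖
        set b := ‖f' x‖ with hb
        set d := ‖f n x - f' x‖
        have hb0 : 0 ≤ b := norm_nonneg _
        have hd0 : 0 ≤ d := norm_nonneg _
        have e3 : 2 * b * d ≤ ε * b^2 + 1/ε * d^2 := by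
          have : ε * b^2 + 1/ε * d^2 - 2 * b * d = (ε * b - d)^2/ε := by field_simp; ring
          have : 0 ≤ (ε * b - d)^2/ε := by positivity
          linarith
        have e4 : a^2 - b^2 = (a-b)^2 + 2*b*(a-b) := by ring
        rw [e4]
        have e5 : (a-b)^2 ≤ d^2 := by rw [← sq_abs (a-b)]; gcongr
        have e6 : |2*b*(a-b)| ≤ 2*b*d := by
          rw [abs_mul, abs_of_nonneg (by positivity : 0 ≤ 2*b)]; gcongr
        have := abs_add_le ((a-b)^2) (2*b*(a-b))
        rw [abs_of_nonneg (sq_nonneg (a-b))] at this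
        linarith
    _ = ε * M + (1 + 1/ε) * ∫ x, ‖f n x - f' x‖ ^ 2 ∂μ := by
        rw [integral_add (hi'.const_mul _) (hd.const_mul _), integral_const_mul,
          integral_const_mul]
    _ ≤ _ := by
        have e : ε * (M + 1) = δ := by rw [hε]; field_simp
        linarith

lemma inv_weight (ε : ℝ) (hε : 0 < ε) : ∃ C, ∀ ω > 0, |(1:ℝ)/ω| ≤ ε * (1/ω^2) + C := by
  refine ⟨1/(4*ε), fun ω hω => ?_⟩
  rw [abs_of_pos (by positivity)]
  have : ε * (1/ω^2) + 1/(4*ε) - 1/ω = (2*ε - ω)^2/(4*ε*ω^2) := by field_simp; ring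
  have : 0 ≤ (2*ε - ω)^2/(4*ε*ω^2) := by positivity
  linarith

lemma log_weight (ε : ℝ) (hε : 0 < ε) : ∃ C, ∀ ω > 0, |Real.log ω| ≤ ε * (Real.log ω)^2 + C := by
  refine ⟨1/(4*ε), fun ω hω => ?_⟩
  rw [← sq_abs]
  set t := |Real.log ω|
  have : ε * t^2 + 1/(4*ε) - t = (2*ε*t - 1)^2/(4*ε) := by field_simp; ring
  have : 0 ≤ (2*ε*t - 1)^2/(4*ε) := by positivity
  linarith

lemma logsq_weight (ε : ℝ) (hε : 0 < ε) :
    ∃ C, ∀ ω > 0, |(Real.log ω)^2/ω| ≤ ε * (1/ω^2) + C := by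
  refine ⟨4 + 16 * (16/ε)^3, fun ω hω => ?_⟩
  rw [abs_of_nonneg (by positivity)]
  obtain ⟨u, hu, rfl⟩ : ∃ u : ℝ, 0 < u ∧ u^4 = ω :=
    ⟨ω^((1:ℝ)/4), by positivity, by rw [← Real.rpow_natCast, ← Real.rpow_mul hω.le]; norm_num⟩
  rw [Real.log_pow]
  push_cast
  obtain h | h := le_total 1 u
  · have h1 : Real.log u ≤ u := (Real.log_le_sub_one_of_pos hu).trans (by linarith)
    have h0 : 0 ≤ Real.log u := Real.log_nonneg h
    have h2 : Real.log (u^2) ≤ u^2 := (Real.log_le_sub_one_of_pos (by positivity)).trans (by linarith)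
    rw [Real.log_pow] at h2
    push_cast at h2
    have : (4 * Real.log u)^2/u^4 ≤ 4 := by
      rw [div_le_iff₀ (by positivity)]
      nlinarith
    have : 0 ≤ ε * (1/(u^4)^2) := by positivity
    have : 0 ≤ 16 * (16/ε)^3 := by positivity
    linarith
  · have h1 : Real.log (1/u) ≤ 1/u := (Real.log_le_sub_one_of_pos (by positivity)).trans (by linarith)
    rw [one_div, Real.log_inv] at h1
    have h0 : Real.log u ≤ 0 := Real.log_nonpos hu.le h
    set v := u⁻¹ with hv
    have hv0 : 0 < v := by positivity
    have e1 : (4 * Real.log u)^2/u^4 = 16 * (Real.log u)^2 * v^4 := by rw [hv]; field_simp; ring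
    have e2 : 1/(u^4)^2 = v^8 := by rw [hv]; field_simp
    rw [e1, e2]
    have e3 : (Real.log u)^2 ≤ v^2 := by nlinarith
    have e4 : 16 * (Real.log u)^2 * v^4 ≤ 16 * v^6 := by
      have := mul_le_mul_of_nonneg_right e3 (by positivity : 0 ≤ 16 * v^4)
      nlinarith
    set s := v^2 with hs
    have e5 : v^6 = s^3 := by rw [hs]; ring
    have e6 : v^8 = s^4 := by rw [hs]; ring
    rw [e5] at e4
    rw [e6]
    obtain h' | h' := le_total s (16/ε)
    · have : s^3 ≤ (16/ε)^3 := by gcongr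
      have : 0 ≤ ε * s^4 := by positivity
      linarith
    · have h'' : 16 ≤ ε * s := by rw [div_le_iff₀ hε] at h'; linarith
      have : 16 * s^3 ≤ ε * s * s^3 := by gcongr
      have : 0 ≤ 16 * (16/ε)^3 := by positivity
      nlinarith

lemma loginv_weight (ε : ℝ) (hε : 0 < ε) :
    ∃ C, ∀ ω > 0, |Real.log ω/ω| ≤ ε * (1/ω^2) + C := by
  obtain ⟨C1, h1⟩ := inv_weight (ε/2) (by positivity)
  obtain ⟨C2, h2⟩ := logsq_weight (ε/2) (by positivity)
  refine ⟨C1 + C2, fun ω hω => ?_⟩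
  have a1 := h1 ω hω
  have a2 := h2 ω hω
  have : |Real.log ω/ω| ≤ |1/ω| + |(Real.log ω)^2/ω| := by
    rw [abs_div, abs_div, abs_div, ← add_div, abs_one, abs_pow]
    gcongr
    nlinarith [sq_nonneg (|Real.log ω| - 1), abs_nonneg (Real.log ω)]
  linarith

lemma weak_aux (K : ℝ) (g : ℕ → ℝ → ℂ) (hg : ∀ n, MemLp (g n) 2 μ₀)
    (hK : ∀ n, ∫ x, ‖g n x‖ ^ 2 ∂μ₀ ≤ K) :
    ∃ g' : ℝ → ℂ, MemLp g' 2 μ₀ ∧ ∫ x, ‖g' x‖ ^ 2 ∂μ₀ ≤ K ∧ ∃ φ : ℕ → ℕ, StrictMono φ ∧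
      ∀ h : ℝ → ℂ, MemLp h 2 μ₀ → Tendsto (fun n => ∫ x, (starRingEnd ℂ) (h x) * g (φ n) x ∂μ₀)
        atTop (𝓝 (∫ x, (starRingEnd ℂ) (h x) * g' x ∂μ₀)) := by
  have hnorm : ∀ k : ℝ → ℂ, (hk : MemLp k 2 μ₀) → ‖hk.toLp k‖ ^ 2 = ∫ x, ‖k x‖ ^ 2 ∂μ₀ := by
    intro k hk
    rw [← @inner_self_eq_norm_sq ℂ, L2.inner_def, ← integral_re (L2.integrable_inner _ _)]
    apply integral_congr_ae
    filter_upwards [hk.coeFn_toLp] with x hx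
    rw [hx, inner_self_eq_norm_sq]
  have hinner : ∀ k l : ℝ → ℂ, (hk : MemLp k 2 μ₀) → (hl : MemLp l 2 μ₀) →
      inner ℂ (hk.toLp k) (hl.toLp l) = ∫ x, (starRingEnd ℂ) (k x) * l x ∂μ₀ := by
    intro k l hk hl
    rw [L2.inner_def]
    apply integral_congr_ae
    filter_upwards [hk.coeFn_toLp, hl.coeFn_toLp] with x hx hy
    rw [hx, hy, RCLike.inner_apply, mul_comm]
  have hK0 : 0 ≤ K := (integral_nonneg fun x => by positivity).trans (hK 0)
  let T := InnerProductSpace.toDual ℂ (Lp ℂ 2 μ₀)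
  have : Fact ((1:ℝ≥0∞) ≤ 2) := ⟨by norm_num⟩
  have : Fact ((2:ℝ≥0∞) ≠ ⊤) := ⟨by norm_num⟩
  have hsc := WeakDual.isSeqCompact_closedBall ℂ (Lp ℂ 2 μ₀) 0 (Real.sqrt K)
  obtain ⟨a, ha, φ, hφ, hlim⟩ := hsc (x := fun n => StrongDual.toWeakDual (T ((hg n).toLp (g n)))) (by
    intro n
    simp only [mem_preimage, mem_closedBall_iff_norm, sub_zero]
    change ‖T ((hg n).toLp (g n))‖ ≤ Real.sqrt K
    rw [LinearIsometryEquiv.norm_map]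
    apply Real.le_sqrt_of_sq_le
    rw [hnorm]
    exact hK n)
  set G := T.symm (WeakDual.toStrongDual a) with hG
  have hGn : ‖G‖ ≤ Real.sqrt K := by
    rw [hG, LinearIsometryEquiv.norm_map]
    simpa using ha
  have hGm : MemLp (G : ℝ → ℂ) 2 μ₀ := Lp.memLp G
  have hGe : hGm.toLp G = G := Lp.toLp_coeFn G hGm
  refine ⟨G, hGm, ?_, φ, hφ, fun h hh => ?_⟩
  · rw [← hnorm _ hGm, hGe]
    calc ‖G‖^2 ≤ (Real.sqrt K)^2 := by gcongr
      _ = K := Real.sq_sqrt hK0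
  · rw [tendsto_iff_forall_eval_tendsto_topDualPairing] at hlim
    have h1 := hlim (hh.toLp h)
    have h2 : Tendsto (fun n => inner ℂ ((hg (φ n)).toLp (g (φ n))) (hh.toLp h)) atTop
        (𝓝 (inner ℂ G (hh.toLp h))) := by
      have e : inner ℂ G (hh.toLp h) = a (hh.toLp h) := by
        rw [hG]
        exact InnerProductSpace.toDual_symm_apply
      rw [e]
      exact h1
    have h3 := (Complex.continuous_conj.tendsto _).comp h2
    rw [inner_conj_symm, ← hGe, hinner] at h3
    refine h3.congr fun n => ?_
    simp only [Function.comp]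
    rw [inner_conj_symm, hinner]

lemma lsc_aux (g : ℕ → ℝ → ℂ) (g' : ℝ → ℂ) (hg : ∀ n, MemLp (g n) 2 μ₀) (hg' : MemLp g' 2 μ₀)
    (hA : ∀ n, Integrable (fun x => x * ‖g n x‖ ^ 2) μ₀)
    (hw : ∀ h : ℝ → ℂ, MemLp h 2 μ₀ → Tendsto (fun n => ∫ x, (starRingEnd ℂ) (h x) * g n x ∂μ₀)
        atTop (𝓝 (∫ x, (starRingEnd ℂ) (h x) * g' x ∂μ₀))) (R : ℝ) :
    Integrable ((Ioc 0 R).indicator (fun x => x * ‖g' x‖ ^ 2)) μ₀ ∧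
    ∃ q : ℕ → ℝ, Tendsto q atTop (𝓝 (∫ x, (Ioc 0 R).indicator (fun x => x * ‖g' x‖ ^ 2) x ∂μ₀)) ∧
      ∀ n, q n ≤ ∫ x, x * ‖g n x‖ ^ 2 ∂μ₀ := by
  set c : ℝ → ℝ := (Ioc 0 R).indicator (fun x => x) with hc
  have hcm : Measurable c := measurable_id.indicator measurableSet_Ioc
  have hc0 : ∀ x, 0 ≤ c x := fun x => indicator_nonneg (fun x hx => hx.1.le) x
  have hcR : ∀ x, c x ≤ |R| := by
    intro x
    rw [hc]
    apply indicator_le' (fun x hx => hx.2.trans (le_abs_self R)) (fun x _ => abs_nonneg R)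
  have hcx : ∀ x > 0, c x ≤ x := by
    intro x hx
    rw [hc]
    exact indicator_le_self' (fun _ _ => hx.le) x
  have e0 : (Ioc 0 R).indicator (fun x => x * ‖g' x‖ ^ 2) = fun x => c x * ‖g' x‖ ^ 2 := by
    funext x
    rw [hc]
    by_cases h : x ∈ Ioc 0 R <;> simp [h]
  rw [e0]
  have hh : MemLp (fun x => (c x : ℂ) * g' x) 2 μ₀ := by
    refine MemLp.of_le_mul (c := |R|) hg'
      ((Complex.measurable_ofReal.comp hcm).aestronglyMeasurable.mul hg'.1) ?_
    refine Eventually.of_forall fun x => ?_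
    rw [norm_mul, Complex.norm_real, Real.norm_eq_abs, abs_of_nonneg (hc0 x)]
    exact mul_le_mul_of_nonneg_right (hcR x) (norm_nonneg _)
  have hi : ∀ k : ℝ → ℂ, MemLp k 2 μ₀ →
      Integrable (fun x => (starRingEnd ℂ) ((c x : ℂ) * g' x) * k x) μ₀ := by
    intro k hk
    have := hh.star.integrable_mul hk
    exact this
  have hint : Integrable (fun x => c x * ‖g' x‖ ^ 2) μ₀ := by
    refine (hi g' hg').re.congr (Eventually.of_forall fun x => ?_)
    have : (starRingEnd ℂ) ((c x : ℂ) * g' x) * g' x = ((c x * ‖g' x‖^2 : ℝ) : ℂ) := by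
      rw [map_mul, Complex.conj_ofReal, mul_assoc, Complex.conj_mul']
      push_cast; ring
    simp only [this]
    exact Complex.ofReal_re _
  refine ⟨hint, fun n => 2 * (∫ x, (starRingEnd ℂ) ((c x : ℂ) * g' x) * g n x ∂μ₀).re -
    ∫ x, c x * ‖g' x‖ ^ 2 ∂μ₀, ?_, fun n => ?_⟩
  · have h1 := (Complex.continuous_re.tendsto _).comp (hw _ hh)
    have h2 : (∫ x, (starRingEnd ℂ) ((c x : ℂ) * g' x) * g' x ∂μ₀).re
        = ∫ x, c x * ‖g' x‖ ^ 2 ∂μ₀ := by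
      have : ∀ x, (starRingEnd ℂ) ((c x : ℂ) * g' x) * g' x = ((c x * ‖g' x‖^2 : ℝ) : ℂ) := by
        intro x
        rw [map_mul, Complex.conj_ofReal, mul_assoc, Complex.conj_mul']
        push_cast; ring
      simp_rw [this]
      rw [integral_complex_ofReal, Complex.ofReal_re]
    rw [h2] at h1
    have h3 := (h1.const_mul 2).sub_const (∫ x, c x * ‖g' x‖ ^ 2 ∂μ₀)
    rw [two_mul, add_sub_cancel_right] at h3
    exact h3
  · have e1 : (∫ x, (starRingEnd ℂ) ((c x : ℂ) * g' x) * g n x ∂μ₀).re =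
        ∫ x, ((starRingEnd ℂ) ((c x : ℂ) * g' x) * g n x).re ∂μ₀ := (integral_re (hi _ (hg n))).symm
    have hr : Integrable (fun x => ((starRingEnd ℂ) ((c x : ℂ) * g' x) * g n x).re) μ₀ :=
      (hi _ (hg n)).re
    dsimp only
    rw [e1, ← integral_const_mul, ← integral_sub (hr.const_mul 2) hint]
    refine integral_mono_ae ((hr.const_mul 2).sub hint) (hA n) ?_
    filter_upwards [ae_restrict_mem measurableSet_Ioi] with x hx
    have e2 : ((starRingEnd ℂ) ((c x : ℂ) * g' x) * g n x).re =
        c x * ((g' x).re * (g n x).re + (g' x).im * (g n x).im) := by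
      simp [Complex.mul_re, Complex.mul_im]; ring
    rw [e2, ← Complex.normSq_eq_norm_sq, ← Complex.normSq_eq_norm_sq, Complex.normSq_apply,
      Complex.normSq_apply]
    have e3 := mul_le_mul_of_nonneg_right (hcx x hx)
      (add_nonneg (mul_self_nonneg (g n x).re) (mul_self_nonneg (g n x).im))
    have e4 := mul_nonneg (hc0 x) (add_nonneg (sq_nonneg ((g n x).re - (g' x).re))
      (sq_nonneg ((g n x).im - (g' x).im)))
    nlinarith

lemma time_aux (K : ℝ) (f g : ℕ → ℝ → ℂ) (f' g' : ℝ → ℂ)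
    (hf : ∀ n, MemLp (f n) 2 μ₀) (hf' : MemLp f' 2 μ₀)
    (hg : ∀ n, MemLp (g n) 2 μ₀) (hK : ∀ n, ∫ x, ‖g n x‖ ^ 2 ∂μ₀ ≤ K)
    (hl : Tendsto (fun n => ∫ x, ‖f n x - f' x‖ ^ 2 ∂μ₀) atTop (𝓝 0))
    (hw : ∀ h : ℝ → ℂ, MemLp h 2 μ₀ → Tendsto (fun n => ∫ x, (starRingEnd ℂ) (h x) * g n x ∂μ₀)
        atTop (𝓝 (∫ x, (starRingEnd ℂ) (h x) * g' x ∂μ₀))) :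
    Tendsto (fun n => ∫ x, (starRingEnd ℂ) (f n x) * g n x ∂μ₀)
        atTop (𝓝 (∫ x, (starRingEnd ℂ) (f' x) * g' x ∂μ₀)) := by
  have hi : ∀ k l : ℝ → ℂ, MemLp k 2 μ₀ → MemLp l 2 μ₀ →
      Integrable (fun x => (starRingEnd ℂ) (k x) * l x) μ₀ := by
    intro k l hk hl
    have := hk.star.integrable_mul hl
    exact this
  have hK0 : 0 ≤ K := (integral_nonneg fun x => by positivity).trans (hK 0)
  have h0 : Tendsto (fun n => ‖(∫ x, (starRingEnd ℂ) (f n x) * g n x ∂μ₀) -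
      ∫ x, (starRingEnd ℂ) (f' x) * g n x ∂μ₀‖) atTop (𝓝 0) := by
    refine squeeze_aux _ _ hl fun δ hδ => ?_
    set ε := δ / (K + 1) with hε
    have hε0 : 0 < ε := by positivity
    refine ⟨1/ε, fun n => ?_⟩
    have hd : Integrable (fun x => ‖f n x - f' x‖ ^ 2) μ₀ :=
      ((hf n).sub hf').integrable_norm_pow two_ne_zero
    have hgi : Integrable (fun x => ‖g n x‖ ^ 2) μ₀ := (hg n).integrable_norm_pow two_ne_zero
    rw [abs_of_nonneg (norm_nonneg _), ← integral_sub (hi _ _ (hf n) (hg n)) (hi _ _ hf' (hg n))]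
    calc ‖∫ x, ((starRingEnd ℂ) (f n x) * g n x - (starRingEnd ℂ) (f' x) * g n x) ∂μ₀‖
        ≤ ∫ x, ‖(starRingEnd ℂ) (f n x) * g n x - (starRingEnd ℂ) (f' x) * g n x‖ ∂μ₀ :=
          norm_integral_le_integral_norm _
      _ ≤ ∫ x, (ε * ‖g n x‖ ^ 2 + 1/ε * ‖f n x - f' x‖ ^ 2) ∂μ₀ := by
          refine integral_mono ((hi _ _ (hf n) (hg n)).sub (hi _ _ hf' (hg n))).norm
            ((hgi.const_mul _).add (hd.const_mul _)) fun x => ?_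
          dsimp only
          rw [← sub_mul, ← map_sub, norm_mul, RCLike.norm_conj]
          set d := ‖f n x - f' x‖
          set b := ‖g n x‖
          have hb0 : 0 ≤ b := norm_nonneg _
          have hd0 : 0 ≤ d := norm_nonneg _
          have : ε * b^2 + 1/ε * d^2 - 2 * b * d = (ε * b - d)^2/ε := by field_simp; ring
          have : 0 ≤ (ε * b - d)^2/ε := by positivity
          have : 0 ≤ b * d := by positivity
          nlinarith
      _ = ε * ∫ x, ‖g n x‖ ^ 2 ∂μ₀ + 1/ε * ∫ x, ‖f n x - f' x‖ ^ 2 ∂μ₀ := by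
          rw [integral_add (hgi.const_mul _) (hd.const_mul _), integral_const_mul,
            integral_const_mul]
      _ ≤ _ := by
          have e : ε * (K + 1) = δ := by rw [hε]; field_simp
          have := mul_le_mul_of_nonneg_left (hK n) hε0.le
          linarith
  have h1 := (tendsto_zero_iff_norm_tendsto_zero.2 h0).add (hw f' hf')
  rw [zero_add] at h1
  exact h1.congr fun n => by ring

lemma pos_aux (f : ℝ → ℂ) (w : ℝ → ℝ) (hw : ∀ x > 0, 0 < w x)
    (hi : Integrable (fun x => w x * ‖f x‖ ^ 2) μ₀) (h1 : ∫ x, ‖f x‖ ^ 2 ∂μ₀ = 1) :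
    0 < ∫ x, w x * ‖f x‖ ^ 2 ∂μ₀ := by
  have hnn : 0 ≤ᵐ[μ₀] fun x => w x * ‖f x‖ ^ 2 := by
    filter_upwards [ae_restrict_mem measurableSet_Ioi] with x hx
    exact mul_nonneg (hw x hx).le (by positivity)
  refine lt_of_le_of_ne (integral_nonneg_of_ae hnn) fun h => ?_
  have h2 := (integral_eq_zero_iff_of_nonneg_ae hnn hi).1 h.symm
  have h3 : ∫ x, ‖f x‖ ^ 2 ∂μ₀ = ∫ x, (0:ℝ) ∂μ₀ := by
    apply integral_congr_ae
    filter_upwards [h2, ae_restrict_mem measurableSet_Ioi] with x hx hx'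
    exact (mul_eq_zero.1 hx).resolve_left (hw x hx').ne'
  rw [h1] at h3
  simp at h3

/-- Reformulated membership conditions. -/
structure Nice (K : ℝ) (f g : ℝ → ℂ) : Prop where
  norm_one : ∫ x, ‖f x‖ ^ 2 ∂μ₀ = 1
  time : ∫ x, (starRingEnd ℂ) (f x) * g x ∂μ₀ = 0
  scale : ∫ x, Real.log x * ‖f x‖ ^ 2 ∂μ₀ = 0
  mf : MemLp f 2 μ₀
  mg : MemLp g 2 μ₀
  iA : Integrable (fun x => x * ‖g x‖ ^ 2) μ₀
  iB : Integrable (fun x => 1 / x ^ 2 * ‖f x‖ ^ 2) μ₀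
  iL : Integrable (fun x => Real.log x ^ 2 * ‖f x‖ ^ 2) μ₀
  b1 : ∫ x, ‖g x‖ ^ 2 ∂μ₀ ≤ K
  b2 : ∫ x, Real.log x ^ 2 * ‖f x‖ ^ 2 ∂μ₀ ≤ K
  b3 : (∫ x, x * ‖g x‖ ^ 2 ∂μ₀) * (∫ x, 1 / x ^ 2 * ‖f x‖ ^ 2 ∂μ₀) ≤
    K * ∫ x, 1 / x * ‖f x‖ ^ 2 ∂μ₀
  b4 : (1 / ∫ x, 1 / x * ‖f x‖ ^ 2 ∂μ₀) * (∫ x, Real.log x ^ 2 / x * ‖f x‖ ^ 2 ∂μ₀) -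
    (1 / (∫ x, 1 / x * ‖f x‖ ^ 2 ∂μ₀) ^ 2) * (∫ x, Real.log x / x * ‖f x‖ ^ 2 ∂μ₀) ^ 2 ≤ K

lemma intW (f : ℝ → ℂ) (hf : MemLp f 2 μ₀)
    (hB : Integrable (fun x => 1 / x ^ 2 * ‖f x‖ ^ 2) μ₀) :
    Integrable (fun x => 1 / x * ‖f x‖ ^ 2) μ₀ := by
  have hi : Integrable (fun x => ‖f x‖ ^ 2) μ₀ := hf.integrable_norm_pow two_ne_zero
  obtain ⟨C, hC⟩ := inv_weight 1 one_pos
  refine Integrable.mono' (hB.add (hi.const_mul C))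
    ((by fun_prop : Measurable fun x : ℝ => 1 / x).aestronglyMeasurable.mul
      hi.aestronglyMeasurable) ?_
  filter_upwards [ae_restrict_mem measurableSet_Ioi] with x hx
  have := mul_le_mul_of_nonneg_right (hC x hx) (sq_nonneg ‖f x‖)
  rw [norm_mul, Real.norm_eq_abs, norm_pow, norm_norm]
  simp only [Pi.add_apply]
  linarith

lemma nice_core (K : ℝ) (b : ℝ) (f g : ℕ → ℝ → ℂ) (f' g' : ℝ → ℂ)
    (hN : ∀ n, Nice K (f n) (g n)) (hf' : MemLp f' 2 μ₀) (hg' : MemLp g' 2 μ₀)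
    (hgK : ∫ x, ‖g' x‖ ^ 2 ∂μ₀ ≤ K)
    (hp : ∀ x > 0, Tendsto (fun n => f n x) atTop (𝓝 (f' x)))
    (hl : Tendsto (fun n => ∫ x, ‖f n x - f' x‖ ^ 2 ∂μ₀) atTop (𝓝 0))
    (hw : ∀ h : ℝ → ℂ, MemLp h 2 μ₀ → Tendsto (fun n => ∫ x, (starRingEnd ℂ) (h x) * g n x ∂μ₀)
        atTop (𝓝 (∫ x, (starRingEnd ℂ) (h x) * g' x ∂μ₀)))
    (hb : Tendsto (fun n => ∫ x, 1 / x ^ 2 * ‖f n x‖ ^ 2 ∂μ₀) atTop (𝓝 b)) :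
    Nice K f' g' := by
  have hsq := sq_diff_aux f f' (fun n => (hN n).mf) hf' hl
  have hi : ∀ n, Integrable (fun x => ‖f n x‖ ^ 2) μ₀ := fun n =>
    (hN n).mf.integrable_norm_pow two_ne_zero
  have hi' : Integrable (fun x => ‖f' x‖ ^ 2) μ₀ := hf'.integrable_norm_pow two_ne_zero
  have hpp : ∀ w : ℝ → ℝ, ∀ᵐ x ∂μ₀, Tendsto (fun n => w x * ‖f n x‖ ^ 2) atTop
      (𝓝 (w x * ‖f' x‖ ^ 2)) := by
    intro w
    filter_upwards [ae_restrict_mem measurableSet_Ioi] with x hx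
    exact ((hp x hx).norm.pow 2).const_mul _
  have hone : ∫ x, ‖f' x‖ ^ 2 ∂μ₀ = 1 := by
    have := weight_aux (fun n x => ‖f n x‖ ^ 2) (fun x => ‖f' x‖ ^ 2) (fun _ => 1) (fun _ => 0) 0
      measurable_const hi hi' (fun _ => le_rfl) (fun _ _ => by positivity) (fun _ => by positivity)
      (by simp) (by simp) (by simp) (by simp) hsq (fun ε _ => ⟨1, by simp⟩)
    simp only [one_mul, (hN _).norm_one] at this
    exact (tendsto_nhds_unique this tendsto_const_nhds)
  obtain ⟨iL, b2⟩ := fatou_aux (fun n x => Real.log x ^ 2 * ‖f n x‖ ^ 2) _ (fun _ => K) K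
    (fun n => (hN n).iL) (fun n => Eventually.of_forall fun x => by dsimp; positivity)
    (hpp fun x => Real.log x ^ 2) (fun n => (hN n).b2) tendsto_const_nhds
  obtain ⟨iB, hBb⟩ := fatou_aux (fun n x => 1 / x ^ 2 * ‖f n x‖ ^ 2) _ _ b
    (fun n => (hN n).iB) (fun n => Eventually.of_forall fun x => by dsimp; positivity)
    (hpp fun x => 1 / x ^ 2) (fun n => le_rfl) hb
  have hscale := weight_aux (fun n x => ‖f n x‖ ^ 2) (fun x => ‖f' x‖ ^ 2) Real.log
    (fun x => Real.log x ^ 2) K Real.measurable_log hi hi' (fun _ => by positivity)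
    (fun _ _ => by positivity) (fun _ => by positivity)
    (fun n => (hN n).iL) iL (fun n => (hN n).b2) b2 hsq log_weight
  simp only [(hN _).scale] at hscale
  have htime := time_aux K f g f' g' (fun n => (hN n).mf) hf' (fun n => (hN n).mg)
    (fun n => (hN n).b1) hl hw
  simp only [(hN _).time] at htime
  obtain ⟨M, hM⟩ := hb.bddAbove_range
  have hM' : ∀ n, ∫ x, 1 / x ^ 2 * ‖f n x‖ ^ 2 ∂μ₀ ≤ M := fun n => hM (mem_range_self n)
  have hbM : b ≤ M := le_of_tendsto' hb hM'
  have hweight : ∀ φ : ℝ → ℝ, Measurable φ →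
      (∀ ε > 0, ∃ C, ∀ ω > 0, |φ ω| ≤ ε * (1/ω^2) + C) →
      Tendsto (fun n => ∫ x, φ x * ‖f n x‖ ^ 2 ∂μ₀) atTop (𝓝 (∫ x, φ x * ‖f' x‖ ^ 2 ∂μ₀)) := by
    intro φ hφ hφw
    exact weight_aux (fun n x => ‖f n x‖ ^ 2) (fun x => ‖f' x‖ ^ 2) φ
      (fun x => 1 / x ^ 2) M hφ hi hi' (fun _ => by positivity)
      (fun _ _ => by positivity) (fun _ => by positivity)
      (fun n => (hN n).iB) iB hM' (hBb.trans hbM) hsq hφw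
  have hW := hweight (fun x => 1 / x) (by fun_prop) inv_weight
  have hLL := hweight (fun x => Real.log x ^ 2 / x) (by fun_prop) logsq_weight
  have hMM := hweight (fun x => Real.log x / x) (by fun_prop) loginv_weight
  have hWpos := pos_aux f' (fun x => 1 / x) (fun x hx => by positivity) (intW f' hf' iB) hone
  have hBpos := pos_aux f' (fun x => 1 / x ^ 2) (fun x hx => by positivity) iB hone
  have hb0 : 0 < b := hBpos.trans_le hBb
  have hlsc := lsc_aux g g' (fun n => (hN n).mg) hg' (fun n => (hN n).iA) hw
  have haR : ∀ R, ∫ x, (Ioc 0 R).indicator (fun x => x * ‖g' x‖ ^ 2) x ∂μ₀ ≤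
      K * (∫ x, 1 / x * ‖f' x‖ ^ 2 ∂μ₀) / b := by
    intro R
    obtain ⟨-, q, hq, hqA⟩ := hlsc R
    rw [le_div_iff₀ hb0]
    refine le_of_tendsto_of_tendsto' (hq.mul hb) (hW.const_mul K) fun n => ?_
    refine le_trans ?_ (hN n).b3
    exact mul_le_mul_of_nonneg_right (hqA n) (integral_nonneg fun x => by positivity)
  obtain ⟨iA, hA⟩ := fatou_aux (fun (n : ℕ) => (Ioc (0:ℝ) n).indicator (fun x => x * ‖g' x‖ ^ 2))
    (fun x => x * ‖g' x‖ ^ 2) _ (K * (∫ x, 1 / x * ‖f' x‖ ^ 2 ∂μ₀) / b)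
    (fun n => (hlsc n).1)
    (fun n => Eventually.of_forall fun x => indicator_nonneg
      (fun x hx => mul_nonneg hx.1.le (by positivity)) x)
    (by
      filter_upwards [ae_restrict_mem measurableSet_Ioi] with x hx
      obtain ⟨N, hN⟩ := exists_nat_ge x
      refine tendsto_const_nhds.congr' ?_
      filter_upwards [eventually_ge_atTop N] with n hn
      rw [indicator_of_mem]
      exact ⟨hx, hN.trans (by exact_mod_cast hn)⟩)
    (fun n => haR n) tendsto_const_nhds
  refine ⟨hone, tendsto_nhds_unique htime tendsto_const_nhds,
    tendsto_nhds_unique hscale tendsto_const_nhds, hf', hg', iA, iB, iL, hgK, b2, ?_, ?_⟩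
  · rw [le_div_iff₀ hb0] at hA
    refine le_trans (mul_le_mul_of_nonneg_left hBb ?_) hA
    apply integral_nonneg_of_ae
    filter_upwards [ae_restrict_mem measurableSet_Ioi] with x hx
    exact mul_nonneg (le_of_lt hx) (by positivity)
  · refine le_of_tendsto' (((tendsto_const_nhds (x := (1:ℝ))).div hW hWpos.ne').mul hLL |>.sub
      (((tendsto_const_nhds (x := (1:ℝ))).div (hW.pow 2) (by positivity)).mul (hMM.pow 2))) fun n => ?_
    exact (hN n).b4

lemma nice_limit (K : ℝ) (hK : 0 < K) (f g : ℕ → ℝ → ℂ) (f' g' : ℝ → ℂ)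
    (hN : ∀ n, Nice K (f n) (g n)) (hf' : MemLp f' 2 μ₀) (hg' : MemLp g' 2 μ₀)
    (hgK : ∫ x, ‖g' x‖ ^ 2 ∂μ₀ ≤ K)
    (hfi : ∀ x > 0, f' x = ∫ t in (0:ℝ)..x, g' t)
    (hp : ∀ x > 0, Tendsto (fun n => f n x) atTop (𝓝 (f' x)))
    (hl : Tendsto (fun n => ∫ x, ‖f n x - f' x‖ ^ 2 ∂μ₀) atTop (𝓝 0))
    (hw : ∀ h : ℝ → ℂ, MemLp h 2 μ₀ → Tendsto (fun n => ∫ x, (starRingEnd ℂ) (h x) * g n x ∂μ₀)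
        atTop (𝓝 (∫ x, (starRingEnd ℂ) (h x) * g' x ∂μ₀))) :
    Nice K f' g' := by
  have hsq := sq_diff_aux f f' (fun n => (hN n).mf) hf' hl
  have hi : ∀ n, Integrable (fun x => ‖f n x‖ ^ 2) μ₀ := fun n =>
    (hN n).mf.integrable_norm_pow two_ne_zero
  have hi' : Integrable (fun x => ‖f' x‖ ^ 2) μ₀ := hf'.integrable_norm_pow two_ne_zero
  have hone : ∫ x, ‖f' x‖ ^ 2 ∂μ₀ = 1 := by
    have := weight_aux (fun n x => ‖f n x‖ ^ 2) (fun x => ‖f' x‖ ^ 2) (fun _ => 1) (fun _ => 0) 0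
      measurable_const hi hi' (fun _ => le_rfl) (fun _ _ => by positivity) (fun _ => by positivity)
      (by simp) (by simp) (by simp) (by simp) hsq (fun ε _ => ⟨1, by simp⟩)
    simp only [one_mul, (hN _).norm_one] at this
    exact (tendsto_nhds_unique this tendsto_const_nhds)
  have hlsc := lsc_aux g g' (fun n => (hN n).mg) hg' (fun n => (hN n).iA) hw
  obtain ⟨R, hR⟩ : ∃ R : ℕ, 0 < ∫ x, (Ioc (0:ℝ) R).indicator (fun x => x * ‖g' x‖ ^ 2) x ∂μ₀ := by
    by_contra! hcon
    have hz : ∀ R : ℕ, ∀ᵐ x ∂μ₀, (Ioc (0:ℝ) R).indicator (fun x => x * ‖g' x‖ ^ 2) x = 0 := by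
      intro R
      have hnn : 0 ≤ (Ioc (0:ℝ) R).indicator (fun x => x * ‖g' x‖ ^ 2) := fun x =>
        indicator_nonneg (fun x hx => mul_nonneg hx.1.le (by positivity)) x
      exact (integral_eq_zero_iff_of_nonneg hnn (hlsc R).1).1
        (le_antisymm (hcon R) (integral_nonneg hnn))
    have hg0 : ∀ᵐ x ∂μ₀, g' x = 0 := by
      filter_upwards [ae_all_iff.2 hz, ae_restrict_mem measurableSet_Ioi] with x hx hx0
      obtain ⟨N, hN⟩ := exists_nat_ge x
      have := hx N
      rw [indicator_of_mem (show x ∈ Ioc (0:ℝ) N from ⟨hx0, hN⟩)] at this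
      have h0 : x ≠ 0 := ne_of_gt hx0
      simpa [h0] using this
    have hf0 : ∀ x > 0, f' x = 0 := by
      intro x hx
      rw [hfi x hx, intervalIntegral.integral_of_le hx.le]
      apply integral_eq_zero_of_ae
      exact ae_restrict_of_ae_restrict_of_subset Ioc_subset_Ioi_self hg0
    have : ∫ x, ‖f' x‖ ^ 2 ∂μ₀ = 0 := by
      apply integral_eq_zero_of_ae
      filter_upwards [ae_restrict_mem measurableSet_Ioi] with x hx
      simp [hf0 x hx]
    linarith
  set a := ∫ x, (Ioc (0:ℝ) R).indicator (fun x => x * ‖g' x‖ ^ 2) x ∂μ₀ with ha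
  obtain ⟨-, q, hq, hqA⟩ := hlsc R
  have hqe := hq.eventually (lt_mem_nhds (show a/2 < a by linarith))
  obtain ⟨C, hC⟩ := inv_weight (a/(4*K)) (by positivity)
  have hbd : ∀ᶠ n in atTop, ∫ x, 1 / x ^ 2 * ‖f n x‖ ^ 2 ∂μ₀ ∈ Icc 0 (4 * K * C / a) := by
    filter_upwards [hqe] with n hn
    have hA := hn.le.trans (hqA n)
    have hB0 : 0 ≤ ∫ x, 1 / x ^ 2 * ‖f n x‖ ^ 2 ∂μ₀ := integral_nonneg fun x => by positivity
    refine ⟨hB0, ?_⟩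
    have hWn : ∫ x, 1 / x * ‖f n x‖ ^ 2 ∂μ₀ ≤
        a/(4*K) * (∫ x, 1 / x ^ 2 * ‖f n x‖ ^ 2 ∂μ₀) + C := by
      have e : a/(4*K) * (∫ x, 1 / x ^ 2 * ‖f n x‖ ^ 2 ∂μ₀) + C =
          ∫ x, (a/(4*K) * (1 / x ^ 2 * ‖f n x‖ ^ 2) + C * ‖f n x‖ ^ 2) ∂μ₀ := by
        rw [integral_add ((hN n).iB.const_mul _) ((hi n).const_mul _), integral_const_mul,
          integral_const_mul, (hN n).norm_one, mul_one]
      rw [e]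
      refine integral_mono_ae (intW _ (hN n).mf (hN n).iB)
        (((hN n).iB.const_mul _).add ((hi n).const_mul _)) ?_
      filter_upwards [ae_restrict_mem measurableSet_Ioi] with x hx
      have := mul_le_mul_of_nonneg_right ((le_abs_self _).trans (hC x hx)) (sq_nonneg ‖f n x‖)
      linarith
    have h3 := (hN n).b3
    set B := ∫ x, 1 / x ^ 2 * ‖f n x‖ ^ 2 ∂μ₀
    have h4 : a/2 * B ≤ K * (a/(4*K) * B + C) :=
      (mul_le_mul_of_nonneg_right hA hB0).trans (h3.trans (mul_le_mul_of_nonneg_left hWn hK.le))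
    have h5 : K * (a/(4*K) * B + C) = a/4*B + K * C := by field_simp
    rw [le_div_iff₀ hR]
    linarith
  obtain ⟨b, -, φ, hφ, hb⟩ := tendsto_subseq_of_frequently_bounded
    (Metric.isBounded_Icc (0:ℝ) (4 * K * C / a)) hbd.frequently
  have hφt := hφ.tendsto_atTop
  exact nice_core K b (fun n => f (φ n)) (fun n => g (φ n)) f' g' (fun n => hN _) hf' hg' hgK
    (fun x hx => (hp x hx).comp hφt) (hl.comp hφt) (fun h hh => (hw h hh).comp hφt) hb

lemma wnorm (x : ℝ) (hx : 0 < x) (z : ℂ) : ‖(Real.sqrt x : ℂ) * z‖ ^ 2 = x * ‖z‖ ^ 2 := by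
  rw [norm_mul, mul_pow, Complex.norm_real, Real.norm_eq_abs, sq_abs, Real.sq_sqrt hx.le]

lemma bnorm (x : ℝ) (z : ℂ) : ‖z / (x : ℂ)‖ ^ 2 = 1 / x ^ 2 * ‖z‖ ^ 2 := by
  rw [norm_div, div_pow, Complex.norm_real, Real.norm_eq_abs, sq_abs]; ring

lemma lnorm (x : ℝ) (z : ℂ) : ‖(Real.log x : ℂ) * z‖ ^ 2 = Real.log x ^ 2 * ‖z‖ ^ 2 := by
  rw [norm_mul, mul_pow, Complex.norm_real, Real.norm_eq_abs, sq_abs]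

lemma nice_iff (K : ℝ) (f g : ℝ → ℂ) (hf : MemLp f 2 μ₀) :
    ((∫ ω in Set.Ioi (0:ℝ), ‖f ω‖ ^ 2 = 1) ∧
    (∫ ω in Set.Ioi (0:ℝ), Complex.I * g ω * (starRingEnd ℂ) (f ω) = 0) ∧
    (∫ ω in Set.Ioi (0:ℝ), Real.log ω * ‖f ω‖ ^ 2 = 0) ∧
    MemLp g 2 (volume.restrict (Set.Ioi (0:ℝ))) ∧
    MemLp (fun ω : ℝ => (Real.sqrt ω : ℂ) * g ω) 2 (volume.restrict (Set.Ioi (0:ℝ))) ∧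
    MemLp (fun ω : ℝ => f ω / (ω : ℂ)) 2 (volume.restrict (Set.Ioi (0:ℝ))) ∧
    MemLp (fun ω : ℝ => (Real.log ω : ℂ) * f ω) 2 (volume.restrict (Set.Ioi (0:ℝ))) ∧
    (∫ ω in Set.Ioi (0:ℝ), ‖g ω‖ ^ 2 ≤ K) ∧
    (∫ ω in Set.Ioi (0:ℝ), (Real.log ω) ^ 2 * ‖f ω‖ ^ 2 ≤ K) ∧
    ((1 / ∫ ω in Set.Ioi (0:ℝ), ‖f ω‖ ^ 2 / ω) *
        ((∫ ω in Set.Ioi (0:ℝ), ω * ‖g ω‖ ^ 2) *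
          (∫ ω in Set.Ioi (0:ℝ), ‖f ω‖ ^ 2 / ω ^ 2)) ≤ K) ∧
    ((1 / ∫ ω in Set.Ioi (0:ℝ), ‖f ω‖ ^ 2 / ω) *
        (∫ ω in Set.Ioi (0:ℝ), (Real.log ω) ^ 2 * ‖f ω‖ ^ 2 / ω) -
      (1 / (∫ ω in Set.Ioi (0:ℝ), ‖f ω‖ ^ 2 / ω) ^ 2) *
        (∫ ω in Set.Ioi (0:ℝ), Real.log ω * ‖f ω‖ ^ 2 / ω) ^ 2 ≤ K)) ↔ Nice K f g := by
  have e1 : (fun ω : ℝ => ‖f ω‖ ^ 2 / ω) = fun ω => 1 / ω * ‖f ω‖ ^ 2 := by funext; ring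
  have e2 : (fun ω : ℝ => ‖f ω‖ ^ 2 / ω ^ 2) = fun ω => 1 / ω ^ 2 * ‖f ω‖ ^ 2 := by funext; ring
  have e3 : (fun ω : ℝ => Real.log ω ^ 2 * ‖f ω‖ ^ 2 / ω) =
    fun ω => Real.log ω ^ 2 / ω * ‖f ω‖ ^ 2 := by funext; ring
  have e4 : (fun ω : ℝ => Real.log ω * ‖f ω‖ ^ 2 / ω) =
    fun ω => Real.log ω / ω * ‖f ω‖ ^ 2 := by funext; ring
  have e5 : (fun ω : ℝ => Complex.I * g ω * (starRingEnd ℂ) (f ω)) =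
    fun ω => Complex.I * ((starRingEnd ℂ) (f ω) * g ω) := by funext; ring
  rw [e1, e2, e3, e4, e5, integral_const_mul, mul_eq_zero, or_iff_right Complex.I_ne_zero]
  have hA : AEStronglyMeasurable g μ₀ →
      (MemLp (fun ω : ℝ => (Real.sqrt ω : ℂ) * g ω) 2 (volume.restrict (Set.Ioi (0:ℝ))) ↔
      Integrable (fun x => x * ‖g x‖ ^ 2) μ₀) := by
    intro hg
    have hm : AEStronglyMeasurable (fun x : ℝ => (Real.sqrt x : ℂ) * g x) μ₀ :=
      (by fun_prop : Measurable fun x : ℝ => (Real.sqrt x : ℂ)).aestronglyMeasurable.mul hg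
    rw [memLp_two_iff_integrable_sq_norm hm]
    apply integrable_congr
    filter_upwards [ae_restrict_mem measurableSet_Ioi] with x hx
    exact wnorm x hx _
  have hB : MemLp (fun ω : ℝ => f ω / (ω : ℂ)) 2 (volume.restrict (Set.Ioi (0:ℝ))) ↔
      Integrable (fun x => 1 / x ^ 2 * ‖f x‖ ^ 2) μ₀ := by
    rw [memLp_two_iff_integrable_sq_norm]
    · simp only [bnorm]
    · simp only [div_eq_mul_inv]
      exact hf.1.mul (by fun_prop : Measurable fun x : ℝ => (x : ℂ)⁻¹).aestronglyMeasurable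
  have hL : MemLp (fun ω : ℝ => (Real.log ω : ℂ) * f ω) 2 (volume.restrict (Set.Ioi (0:ℝ))) ↔
      Integrable (fun x => Real.log x ^ 2 * ‖f x‖ ^ 2) μ₀ := by
    have hm : AEStronglyMeasurable (fun x : ℝ => (Real.log x : ℂ) * f x) μ₀ :=
      (by fun_prop : Measurable fun x : ℝ => (Real.log x : ℂ)).aestronglyMeasurable.mul hf.1
    rw [memLp_two_iff_integrable_sq_norm hm]
    simp only [lnorm]
  rw [hB, hL]
  have h3 : Integrable (fun x => 1 / x ^ 2 * ‖f x‖ ^ 2) μ₀ → ∫ x, ‖f x‖ ^ 2 ∂μ₀ = 1 →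
      0 < ∫ x, 1 / x * ‖f x‖ ^ 2 ∂μ₀ := fun h1 h2 =>
    pos_aux f (fun x => 1 / x) (fun x hx => by positivity) (intW f hf h1) h2
  constructor
  · rintro ⟨a1, a2, a3, a4, a5, a6, a7, a8, a9, a10, a11⟩
    refine ⟨a1, a2, a3, hf, a4, (hA a4.1).1 a5, a6, a7, a8, a9, ?_, a11⟩
    rwa [one_div_mul_eq_div, div_le_iff₀ (h3 a6 a1)] at a10
  · rintro ⟨a1, a2, a3, -, a4, a5, a6, a7, a8, a9, a10, a11⟩
    refine ⟨a1, a2, a3, a4, (hA a4.1).2 a5, a6, a7, a8, a9, ?_, a11⟩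
    rwa [one_div_mul_eq_div, div_le_iff₀ (h3 a6 a1)]

lemma ftc_aux (g : ℝ → ℂ) (x : ℝ) (hx : 0 < x) :
    ∫ y, (starRingEnd ℂ) ((Ioc 0 x).indicator (fun _ => (1:ℂ)) y) * g y ∂μ₀ =
      ∫ t in (0:ℝ)..x, g t := by
  rw [intervalIntegral.integral_of_le hx.le]
  have : (fun y => (starRingEnd ℂ) ((Ioc 0 x).indicator (fun _ => (1:ℂ)) y) * g y) =
      (Ioc 0 x).indicator g := by
    funext y
    by_cases h : y ∈ Ioc 0 x <;> simp [h]
  rw [this, setIntegral_indicator measurableSet_Ioc,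
    inter_eq_self_of_subset_right Ioc_subset_Ioi_self]

/-- For any `K > 0`, the set `K_P` is closed in `L²((0,∞))`. -/
theorem isClosed_KP (K : ℝ) (hK : 0 < K) : IsClosed (KP K) := by
  apply IsSeqClosed.isClosed
  intro F F' hF hlim
  choose f g hFf hsupp hii hint hrest using hF
  have hfv : ∀ n, MemLp (f n) 2 volume := fun n => (Lp.memLp (F n)).ae_eq (hFf n)
  have hN : ∀ n, Nice K (f n) (g n) := fun n => (nice_iff K _ _ ((hfv n).restrict _)).1 (hrest n)
  obtain ⟨g₀, hg₀, hgK₀, φ, hφ, hw₀⟩ := weak_aux K g (fun n => (hN n).mg) (fun n => (hN n).b1)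
  set g' : ℝ → ℂ := (Ioi (0:ℝ)).indicator g₀ with hg'd
  have hge : g₀ =ᵐ[μ₀] g' := by
    filter_upwards [ae_restrict_mem measurableSet_Ioi] with x hx
    rw [hg'd, indicator_of_mem hx]
  have hg' : MemLp g' 2 μ₀ := hg₀.ae_eq hge
  have hgK : ∫ x, ‖g' x‖ ^ 2 ∂μ₀ ≤ K := by
    have e : ∫ x, ‖g₀ x‖ ^ 2 ∂μ₀ = ∫ x, ‖g' x‖ ^ 2 ∂μ₀ :=
      integral_congr_ae (hge.mono fun x hx => by simp only [hx])
    rwa [← e]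
  have hw : ∀ h : ℝ → ℂ, MemLp h 2 μ₀ →
      Tendsto (fun n => ∫ x, (starRingEnd ℂ) (h x) * g (φ n) x ∂μ₀)
        atTop (𝓝 (∫ x, (starRingEnd ℂ) (h x) * g' x ∂μ₀)) := by
    intro h hh
    have e : ∫ x, (starRingEnd ℂ) (h x) * g₀ x ∂μ₀ = ∫ x, (starRingEnd ℂ) (h x) * g' x ∂μ₀ :=
      integral_congr_ae (hge.mono fun x hx => by simp only [hx])
    rw [← e]
    exact hw₀ h hh
  have hg'v : MemLp g' 2 volume := (memLp_indicator_iff_restrict measurableSet_Ioi).2 hg₀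
  have hii' : ∀ x, IntervalIntegrable g' volume 0 x := fun x =>
    ((hg'v.locallyIntegrable (by norm_num)).integrableOn_isCompact
      isCompact_uIcc).intervalIntegrable
  set f' : ℝ → ℂ := fun x => ∫ t in (0:ℝ)..x, g' t with hf'd
  have hsupp' : ∀ x ≤ 0, f' x = 0 := by
    intro x hx
    rw [hf'd]
    dsimp only
    rw [intervalIntegral.integral_of_ge hx, neg_eq_zero]
    apply integral_eq_zero_of_ae
    filter_upwards [ae_restrict_mem measurableSet_Ioc] with y hy
    rw [hg'd, indicator_of_notMem (show y ∉ Ioi (0:ℝ) from not_lt.2 hy.2)]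
    rfl
  have hp : ∀ x > 0, Tendsto (fun n => f (φ n) x) atTop (𝓝 (f' x)) := by
    intro x hx
    have h1 : MemLp ((Ioc 0 x).indicator (fun _ => (1:ℂ))) 2 μ₀ :=
      (memLp_indicator_const 2 measurableSet_Ioc (1:ℂ) (Or.inr (by simp))).restrict _
    have h2 := hw _ h1
    rw [ftc_aux _ x hx] at h2
    refine h2.congr fun n => ?_
    rw [ftc_aux _ x hx, hint]
  have hlimφ : Tendsto (fun n => F (φ n)) atTop (𝓝 F') := hlim.comp hφ.tendsto_atTop
  have hFf' : F' =ᵐ[volume] f' := by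
    obtain ⟨ψ, hψ, hae⟩ := (tendstoInMeasure_of_tendsto_Lp hlimφ).exists_seq_tendsto_ae
    filter_upwards [hae, ae_all_iff.2 hFf] with x hx hall
    refine tendsto_nhds_unique hx ?_
    simp only [hall]
    obtain h | h := le_or_gt x 0
    · rw [hsupp' x h]
      simp only [hsupp _ x h]
      exact tendsto_const_nhds
    · exact (hp x h).comp hψ.tendsto_atTop
  have hf'v : MemLp f' 2 volume := (Lp.memLp F').ae_eq hFf'
  have hl : Tendsto (fun n => ∫ x, ‖f (φ n) x - f' x‖ ^ 2 ∂μ₀) atTop (𝓝 0) := by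
    have h0 : Tendsto (fun n => ‖F (φ n) - F'‖ ^ 2) atTop (𝓝 0) := by
      have := (tendsto_iff_norm_sub_tendsto_zero.1 hlimφ).pow 2
      simpa using this
    refine squeeze_zero (fun n => integral_nonneg fun x => by positivity) (fun n => ?_) h0
    have e : ‖F (φ n) - F'‖ ^ 2 = ∫ x, ‖f (φ n) x - f' x‖ ^ 2 := by
      rw [← @inner_self_eq_norm_sq ℂ, L2.inner_def, ← integral_re (L2.integrable_inner _ _)]
      apply integral_congr_ae
      filter_upwards [Lp.coeFn_sub (F (φ n)) F', hFf (φ n), hFf'] with x h1 h2 h3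
      rw [h1, inner_self_eq_norm_sq, Pi.sub_apply, h2, h3]
    rw [e]
    exact setIntegral_le_integral (((hfv _).sub hf'v).integrable_norm_pow two_ne_zero)
      (Eventually.of_forall fun x => by dsimp; positivity)
  have hfinal := nice_limit K hK (fun n => f (φ n)) (fun n => g (φ n)) f' g' (fun n => hN _)
    (hf'v.restrict _) hg' hgK (fun x _ => rfl) hp hl hw
  exact ⟨f', g', hFf', hsupp', hii', fun x => rfl, (nice_iff K _ _ (hf'v.restrict _)).2 hfinal⟩
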